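/- arXiv:0903.0459 — 2 statements merged into one kernel-verified Lean document; each statement's English description precedes it below -/
import Mathlib

section
/- Let X ⊆ ℝ, let f : X → X be Borel measurable, and let μ be an f-invariant Borel probability measure on X. Then there exists a set X̃ in the Borel σ-algebra of X with μ(X̃) = 1 and f(X̃) ⊆ X̃ such that for every x ∈ X̃ the limit α(x) := lim_{d→∞} i_{d,d}(x)/d exists (equivalently, the limit lim_{d→∞} (1/d)·#{i ∈ {1,…,d} : f^{∘i}(x) ≤ x} exists). -/
open MeasureTheory Filter Set Function
open scoped Classical ENNReal Topology

noncomputable section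

/-- `ordIdx f d l x` is the inversion number `i_{d,l}(x)`, the `l`-th entry of the
ordinal pattern of order `d` realized by `x`:
`i_{d,l}(x) = #{r ∈ {0,…,l-1} : f^[d-r] x ≤ f^[d-l] x}`. -/
def ordIdx {X : Set ℝ} (f : X → X) (d l : ℕ) (x : X) : ℕ :=
  ((Finset.range l).filter (fun r => f^[d - r] x ≤ f^[d - l] x)).card

/-- The maximum of the Birkhoff sums `birkhoffSum f g k`, `0 ≤ k ≤ n`, defined recursively. -/
def birkhoffMax {α : Type*} (f : α → α) (g : α → ℝ) : ℕ → α → ℝ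
  | 0 => fun _ => 0
  | n + 1 => fun x => max 0 (g x + birkhoffMax f g n (f x))

section birkhoffMax

variable {α : Type*} {f : α → α} {g : α → ℝ}

lemma birkhoffMax_nonneg (n : ℕ) (x : α) : 0 ≤ birkhoffMax f g n x := by
  cases n with
  | zero => exact le_rfl
  | succ n => exact le_max_left _ _

lemma birkhoffMax_le_succ (n : ℕ) (x : α) : birkhoffMax f g n x ≤ birkhoffMax f g (n + 1) x := by
  induction n generalizing x with
  | zero => exact birkhoffMax_nonneg _ _
  | succ n ih =>
    have := ih (f x)
    change max 0 (g x + birkhoffMax f g n (f x)) ≤ max 0 (g x + birkhoffMax f g (n + 1) (f x))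
    gcongr

lemma birkhoffSum_le_birkhoffMax (n : ℕ) (x : α) : birkhoffSum f g n x ≤ birkhoffMax f g n x := by
  induction n generalizing x with
  | zero => simp [birkhoffMax]
  | succ n ih =>
    rw [birkhoffSum_succ']
    exact le_max_of_le_right (by gcongr; exact ih _)

variable [MeasurableSpace α] {μ : Measure α}

lemma measurable_birkhoffMax (hf : Measurable f) (hg : Measurable g) (n : ℕ) :
    Measurable (birkhoffMax f g n) := by
  induction n with
  | zero => exact measurable_const
  | succ n ih => exact measurable_const.max (hg.add (ih.comp hf))

lemma integrable_birkhoffMax (hf : MeasurePreserving f μ μ) (hg : Integrable g μ) (n : ℕ) :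
    Integrable (birkhoffMax f g n) μ := by
  induction n with
  | zero => exact integrable_zero _ _ _
  | succ n ih => exact (integrable_zero _ _ _).sup (hg.add (hf.integrable_comp_of_integrable ih))

/-- Hopf's maximal ergodic inequality, for the first `n` Birkhoff sums. -/
lemma setIntegral_nonneg_of_birkhoffMax_pos (hf : MeasurePreserving f μ μ) (hg : Measurable g)
    (hgi : Integrable g μ) (n : ℕ) : 0 ≤ ∫ x in {x | 0 < birkhoffMax f g n x}, g x ∂μ := by
  set M := birkhoffMax f g n with hM
  have hMm : Measurable M := measurable_birkhoffMax hf.measurable hg n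
  have hMi : Integrable M μ := integrable_birkhoffMax hf hgi n
  have hMf : Integrable (M ∘ f) μ := hf.integrable_comp_of_integrable hMi
  have hs : MeasurableSet {x | 0 < M x} := measurableSet_lt measurable_const hMm
  have hpos : ∀ x ∈ {x | 0 < M x}, M x - (M ∘ f) x ≤ g x := by
    intro x hx
    have hx : 0 < M x := hx
    cases n with
    | zero => simp [hM, birkhoffMax] at hx
    | succ n =>
      have h1 : M x = max 0 (g x + birkhoffMax f g n (f x)) := rfl
      have h2 : birkhoffMax f g n (f x) ≤ M (f x) := birkhoffMax_le_succ n (f x)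
      rcases max_cases 0 (g x + birkhoffMax f g n (f x)) with h | h
      · linarith
      · simp only [comp_apply]; linarith
  have hM_eq : ∫ x in {x | 0 < M x}, M x ∂μ = ∫ x, M x ∂μ := by
    refine setIntegral_eq_integral_of_forall_compl_eq_zero fun x hx => ?_
    exact le_antisymm (not_lt.1 hx) (birkhoffMax_nonneg n x)
  have hMf_le : ∫ x in {x | 0 < M x}, (M ∘ f) x ∂μ ≤ ∫ x, (M ∘ f) x ∂μ :=
    setIntegral_le_integral hMf (ae_of_all _ fun x => birkhoffMax_nonneg n (f x))
  have hMf_eq : ∫ x, (M ∘ f) x ∂μ = ∫ x, M x ∂μ := by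
    conv_rhs => rw [← hf.map_eq]
    rw [integral_map hf.aemeasurable hMm.aestronglyMeasurable]
    rfl
  have := setIntegral_mono_on (hMi.sub hMf).integrableOn hgi.integrableOn hs hpos
  simp only [Pi.sub_apply] at this
  rw [integral_sub hMi.integrableOn hMf.integrableOn] at this
  linarith

/-- If almost every point has a positive Birkhoff sum of `g`, then `g` has nonnegative integral. -/
lemma integral_nonneg_of_ae_exists_birkhoffSum_pos (hf : MeasurePreserving f μ μ)
    (hg : Measurable g) (hgi : Integrable g μ)
    (h : ∀ᵐ x ∂μ, ∃ n, 0 < birkhoffSum f g n x) : 0 ≤ ∫ x, g x ∂μ := by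
  have hmono : Monotone fun n => {x | 0 < birkhoffMax f g n x} :=
    monotone_nat_of_le_succ fun n x hx => lt_of_lt_of_le hx (birkhoffMax_le_succ n x)
  have hlim := tendsto_setIntegral_of_monotone (μ := μ) (f := g)
    (fun n => measurableSet_lt measurable_const (measurable_birkhoffMax hf.measurable hg n))
    hmono hgi.integrableOn
  have huniv : (⋃ n, {x | 0 < birkhoffMax f g n x}) =ᵐ[μ] univ := by
    refine eventuallyEq_univ.2 ?_
    filter_upwards [h] with x ⟨n, hn⟩
    exact mem_iUnion.2 ⟨n, lt_of_lt_of_le hn (birkhoffSum_le_birkhoffMax n x)⟩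
  rw [setIntegral_congr_set huniv, setIntegral_univ] at hlim
  exact ge_of_tendsto' hlim fun n => setIntegral_nonneg_of_birkhoffMax_pos hf hg hgi n

end birkhoffMax

section birkhoffAverage

variable {α : Type*} {f : α → α} {g : α → ℝ} {x : α}

lemma tendsto_birkhoffAverage_apply_iff (hb : Bornology.IsBounded (range g)) {a : ℝ} :
    Tendsto (birkhoffAverage ℝ f g · (f x)) atTop (𝓝 a) ↔
      Tendsto (birkhoffAverage ℝ f g · x) atTop (𝓝 a) := by
  have h := tendsto_birkhoffAverage_apply_sub_birkhoffAverage' ℝ hb f x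
  exact ⟨fun h1 => by simpa using h1.sub h, fun h1 => by simpa using h.add h1⟩

lemma tendsto_birkhoffAverage_iterate_iff (hb : Bornology.IsBounded (range g)) {a : ℝ} (m : ℕ) :
    Tendsto (birkhoffAverage ℝ f g · (f^[m] x)) atTop (𝓝 a) ↔
      Tendsto (birkhoffAverage ℝ f g · x) atTop (𝓝 a) := by
  induction m with
  | zero => rfl
  | succ m ih => rw [iterate_succ_apply', tendsto_birkhoffAverage_apply_iff hb, ih]

lemma exists_tendsto_birkhoffAverage_of_isPeriodicPt {p : ℕ} (hp : 0 < p)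
    (hx : IsPeriodicPt f p x) : ∃ a, Tendsto (birkhoffAverage ℝ f g · x) atTop (𝓝 a) := by
  set a : ℝ := birkhoffSum f g p x / p with ha
  have hp' : (p : ℝ) ≠ 0 := by positivity
  set b : ℕ → ℝ := fun n => birkhoffSum f g n x - n * a with hbdef
  have hper : Periodic b p := by
    intro n
    have : birkhoffSum f g (n + p) x = birkhoffSum f g p x + birkhoffSum f g n x := by
      rw [add_comm n p, birkhoffSum_add, hx.eq]
    simp only [hbdef, this]
    rw [show birkhoffSum f g p x = p * a by rw [ha]; field_simp]
    push_cast
    ring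
  have hbound : ∀ n, |b n| ≤ ∑ j ∈ Finset.range p, |b j| := by
    intro n
    rw [← hper.map_mod_nat n]
    exact Finset.single_le_sum (f := fun j => |b j|) (fun _ _ => abs_nonneg _)
      (Finset.mem_range.2 (Nat.mod_lt _ hp))
  refine ⟨a, tendsto_iff_norm_sub_tendsto_zero.2 ?_⟩
  refine squeeze_zero' (Eventually.of_forall fun _ => norm_nonneg _) ?_
    (tendsto_const_div_atTop_nhds_zero_nat (∑ j ∈ Finset.range p, |b j|))
  filter_upwards [eventually_gt_atTop 0] with n hn
  have hn' : (0 : ℝ) < n := by exact_mod_cast hn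
  have : birkhoffAverage ℝ f g n x - a = b n / n := by
    simp only [birkhoffAverage, hbdef, smul_eq_mul]
    field_simp
  rw [this, Real.norm_eq_abs, abs_div, abs_of_pos hn']
  gcongr
  exact hbound n

lemma exists_tendsto_birkhoffAverage_of_iterate_eq (hb : Bornology.IsBounded (range g))
    {m n : ℕ} (hmn : m < n) (h : f^[m] x = f^[n] x) :
    ∃ a, Tendsto (birkhoffAverage ℝ f g · x) atTop (𝓝 a) := by
  have hper : IsPeriodicPt f (n - m) (f^[m] x) := by
    rw [IsPeriodicPt, IsFixedPt, ← iterate_add_apply, Nat.sub_add_cancel hmn.le, h]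
  obtain ⟨a, ha⟩ :=
    exists_tendsto_birkhoffAverage_of_isPeriodicPt (g := g) (Nat.sub_pos_of_lt hmn) hper
  exact ⟨a, (tendsto_birkhoffAverage_iterate_iff hb m).1 ha⟩

/-- The set of points at which the upper limit of the Birkhoff averages of `g` exceeds `b`. -/
def upperBirkhoffSet (f : α → α) (g : α → ℝ) (b : ℝ) : Set α :=
  {x | ∃ q : ℚ, b < q ∧ ∃ᶠ n in atTop, (q : ℝ) < birkhoffAverage ℝ f g n x}

lemma preimage_upperBirkhoffSet (hb : Bornology.IsBounded (range g)) (b : ℝ) :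
    f ⁻¹' upperBirkhoffSet f g b = upperBirkhoffSet f g b := by
  have key : ∀ u v : ℕ → ℝ, Tendsto (fun n => u n - v n) atTop (𝓝 0) →
      (∃ q : ℚ, b < q ∧ ∃ᶠ n in atTop, (q : ℝ) < u n) →
      ∃ q : ℚ, b < q ∧ ∃ᶠ n in atTop, (q : ℝ) < v n := by
    rintro u v huv ⟨q, hq, hu⟩
    obtain ⟨r, hbr, hrq⟩ := exists_rat_btwn hq
    refine ⟨r, hbr, (hu.and_eventually (huv.eventually_lt_const (sub_pos.2 hrq))).mono ?_⟩
    rintro n ⟨h1, h2⟩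
    linarith
  ext x
  have h := tendsto_birkhoffAverage_apply_sub_birkhoffAverage' ℝ hb f x
  exact ⟨key _ _ h, key _ _ (by simpa using h.neg)⟩

variable [MeasurableSpace α] {μ : Measure α}

lemma measurable_birkhoffAverage (hf : Measurable f) (hg : Measurable g) (n : ℕ) :
    Measurable (birkhoffAverage ℝ f g n) := by
  unfold birkhoffAverage birkhoffSum
  exact (Finset.measurable_fun_sum _ fun k _ => hg.comp (hf.iterate k)).const_mul _

lemma measurableSet_upperBirkhoffSet (hf : Measurable f) (hg : Measurable g) (b : ℝ) :
    MeasurableSet (upperBirkhoffSet f g b) := by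
  have : upperBirkhoffSet f g b = ⋃ (q : ℚ) (_ : b < q), ⋂ N : ℕ, ⋃ n ≥ N,
      {x | (q : ℝ) < birkhoffAverage ℝ f g n x} := by
    ext x
    simp [upperBirkhoffSet, frequently_atTop]
  rw [this]
  refine .iUnion fun q => .iUnion fun _ => .iInter fun N => .iUnion fun n => .iUnion fun _ => ?_
  exact measurableSet_lt measurable_const (measurable_birkhoffAverage hf hg n)

lemma mul_measureReal_le_setIntegral [IsFiniteMeasure μ] (hf : MeasurePreserving f μ μ)
    (hg : Measurable g) (hgi : Integrable g μ) {b : ℝ} {E : Set α} (hE : MeasurableSet E)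
    (hinv : f ⁻¹' E = E) (hsub : E ⊆ upperBirkhoffSet f g b) :
    b * μ.real E ≤ ∫ x in E, g x ∂μ := by
  have hfE : MeasurePreserving f (μ.restrict E) (μ.restrict E) := by
    simpa [hinv] using hf.restrict_preimage hE
  have hsum : ∀ᵐ x ∂μ.restrict E, ∃ n, 0 < birkhoffSum f (fun y => g y - b) n x := by
    filter_upwards [ae_restrict_mem hE] with x hx
    obtain ⟨q, hbq, hq⟩ := hsub hx
    obtain ⟨n, hqn, hn⟩ := (hq.and_eventually (eventually_gt_atTop 0)).exists
    have hn' : (0 : ℝ) < n := by exact_mod_cast hn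
    refine ⟨n, ?_⟩
    have h1 : b < (n : ℝ)⁻¹ * birkhoffSum f g n x := hbq.trans hqn
    rw [inv_mul_eq_div, lt_div_iff₀ hn'] at h1
    have h2 : birkhoffSum f (fun y => g y - b) n x = birkhoffSum f g n x - n * b := by
      simp [birkhoffSum]
    rw [h2]
    linarith
  have h := integral_nonneg_of_ae_exists_birkhoffSum_pos hfE (hg.sub_const b)
    (hgi.integrableOn.sub (integrable_const b)) hsum
  rw [integral_sub hgi.integrableOn (integrable_const b), integral_const] at h
  simp only [measureReal_restrict_apply_univ, smul_eq_mul] at h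
  linarith

/-- Birkhoff's pointwise ergodic theorem for bounded functions, without identification of the
limit. -/
theorem ae_exists_tendsto_birkhoffAverage [IsFiniteMeasure μ] (hf : MeasurePreserving f μ μ)
    (hg : Measurable g) {C : ℝ} (hC : ∀ x, |g x| ≤ C) :
    ∀ᵐ x ∂μ, ∃ a, Tendsto (birkhoffAverage ℝ f g · x) atTop (𝓝 a) := by
  have hb : Bornology.IsBounded (range g) :=
    isBounded_iff_forall_norm_le.2 ⟨C, by rintro _ ⟨x, rfl⟩; exact hC x⟩
  have hb' : Bornology.IsBounded (range (-g)) :=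
    isBounded_iff_forall_norm_le.2 ⟨C, by rintro _ ⟨x, rfl⟩; simpa using hC x⟩
  have hgi : Integrable g μ := .of_bound hg.aestronglyMeasurable C (ae_of_all _ hC)
  have hnull : ∀ a b : ℚ, (a : ℝ) < b →
      μ (upperBirkhoffSet f g b ∩ upperBirkhoffSet f (-g) (-a)) = 0 := by
    intro a b hab
    set E := upperBirkhoffSet f g b ∩ upperBirkhoffSet f (-g) (-a) with hEdef
    have hE : MeasurableSet E := (measurableSet_upperBirkhoffSet hf.measurable hg _).inter
      (measurableSet_upperBirkhoffSet hf.measurable hg.neg _)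
    have hinv : f ⁻¹' E = E := by
      rw [hEdef, preimage_inter, preimage_upperBirkhoffSet hb, preimage_upperBirkhoffSet hb']
    have h1 := mul_measureReal_le_setIntegral hf hg hgi hE hinv inter_subset_left
    have h2 := mul_measureReal_le_setIntegral hf hg.neg hgi.neg hE hinv inter_subset_right
    simp only [Pi.neg_apply, integral_neg] at h2
    have h3 : 0 ≤ μ.real E := measureReal_nonneg
    refine (measureReal_eq_zero_iff).1 ?_
    nlinarith
  have hae : ∀ᵐ x ∂μ, ∀ a b : ℚ, (a : ℝ) < b →
      x ∉ upperBirkhoffSet f g b ∩ upperBirkhoffSet f (-g) (-a) := by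
    simp only [ae_all_iff]
    exact fun a b hab => measure_eq_zero_iff_ae_notMem.1 (hnull a b hab)
  have hbdd : ∀ x n, |birkhoffAverage ℝ f g n x| ≤ C := by
    intro x n
    have hC0 : 0 ≤ C := (abs_nonneg _).trans (hC x)
    rcases n.eq_zero_or_pos with rfl | hn
    · simpa
    have hn' : (0 : ℝ) < n := by exact_mod_cast hn
    have : |birkhoffSum f g n x| ≤ n * C := by
      refine (Finset.abs_sum_le_sum_abs _ _).trans ?_
      simpa using Finset.sum_le_sum fun k (_ : k ∈ Finset.range n) => hC (f^[k] x)
    rw [birkhoffAverage, smul_eq_mul, inv_mul_eq_div, abs_div, abs_of_pos hn', div_le_iff₀ hn']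
    linarith
  filter_upwards [hae] with x hx
  refine tendsto_of_no_upcrossings dense_univ ?_
    (isBoundedUnder_of ⟨C, fun n => (abs_le.1 (hbdd x n)).2⟩)
    (isBoundedUnder_of ⟨-C, fun n => (abs_le.1 (hbdd x n)).1⟩)
  rintro a - b - hab ⟨ha, hb⟩
  obtain ⟨r₂, har₂, hr₂b⟩ := exists_rat_btwn hab
  obtain ⟨r₁, har₁, hr₁⟩ := exists_rat_btwn har₂
  obtain ⟨a', haa', ha'⟩ := exists_rat_btwn har₁
  obtain ⟨b', hbb', hb'⟩ := exists_rat_btwn hr₂b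
  refine hx r₁ r₂ hr₁ ⟨⟨b', hbb', hb.mono fun n hn => hb'.trans hn⟩, -a', ?_, ?_⟩
  · push_cast; linarith
  · refine ha.mono fun n hn => ?_
    rw [birkhoffAverage_neg]
    simp only [Rat.cast_neg, Pi.neg_apply]
    linarith

end birkhoffAverage

/-- The points at which a function on `ℚ`, seen as a function on the line, has a jump of size at
least `δ`. -/
def jumpSet (F : ℚ → ℝ) (δ : ℝ) : Set ℝ :=
  {t : ℝ | ∀ q q' : ℚ, (q : ℝ) < t → t < q' → δ ≤ F q' - F q}

lemma card_mul_le_of_subset_jumpSet {F : ℚ → ℝ} (hF : Monotone F) {δ : ℝ} (s : Finset ℝ)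
    (hs : ↑s ⊆ jumpSet F δ) {q q' : ℚ} (hqq' : q ≤ q') (hq : ∀ t ∈ s, q < t)
    (hq' : ∀ t ∈ s, t < q') : s.card * δ ≤ F q' - F q := by
  induction s using Finset.induction_on_max generalizing q' with
  | empty => simpa using hF hqq'
  | insert a s hmax ih =>
    have ha : a ∉ s := fun h => lt_irrefl _ (hmax a h)
    have hlt : (insert (q : ℝ) s).max' (Finset.insert_nonempty _ _) < a := by
      rw [Finset.max'_lt_iff]
      intro y hy
      rcases Finset.mem_insert.1 hy with rfl | hy
      · exact hq a (Finset.mem_insert_self _ _)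
      · exact hmax y hy
    obtain ⟨r, hr, hra⟩ := exists_rat_btwn hlt
    rw [Finset.max'_lt_iff] at hr
    have hqr : (q : ℝ) < r := hr _ (Finset.mem_insert_self _ _)
    have h1 := ih (fun t ht => hs (Finset.mem_insert_of_mem ht)) (q' := r)
      (by exact_mod_cast hqr.le) (fun t ht => hq t (Finset.mem_insert_of_mem ht))
      (fun t ht => hr t (Finset.mem_insert_of_mem ht))
    have h2 := hs (Finset.mem_insert_self a s) r q' hra (hq' a (Finset.mem_insert_self _ _))
    rw [Finset.card_insert_of_notMem ha]
    push_cast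
    linarith

lemma finite_jumpSet {F : ℚ → ℝ} (hF : Monotone F) (h0 : ∀ q, 0 ≤ F q) (h1 : ∀ q, F q ≤ 1)
    {δ : ℝ} (hδ : 0 < δ) : (jumpSet F δ).Finite := by
  obtain ⟨N, hN⟩ := exists_nat_gt (1 / δ)
  by_contra hinf
  obtain ⟨s, hsD, hs⟩ := Set.Infinite.exists_subset_card_eq hinf N
  obtain ⟨B, hB⟩ := s.bddAbove
  obtain ⟨A, hA⟩ := s.bddBelow
  obtain ⟨q, hq⟩ := exists_rat_lt A
  obtain ⟨q', hq'⟩ := exists_rat_gt (max B q)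
  have h := card_mul_le_of_subset_jumpSet hF s hsD (q := q) (q' := q')
    (by exact_mod_cast ((le_max_right _ _).trans_lt hq').le)
    (fun t ht => hq.trans_le (hA ht)) (fun t ht => ((hB ht).trans (le_max_left _ _)).trans_lt hq')
  rw [hs] at h
  rw [div_lt_iff₀ hδ] at hN
  linarith [h0 q, h1 q']

section lowerIndicator

variable {X : Set ℝ}

/-- The indicator function of `{y | y ≤ t}`. -/
def lowerIndicator (X : Set ℝ) (t : ℝ) (y : X) : ℝ := if (y : ℝ) ≤ t then 1 else 0

lemma lowerIndicator_nonneg (t : ℝ) (y : X) : 0 ≤ lowerIndicator X t y := by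
  unfold lowerIndicator; split_ifs <;> norm_num

lemma lowerIndicator_le_one (t : ℝ) (y : X) : lowerIndicator X t y ≤ 1 := by
  unfold lowerIndicator; split_ifs <;> norm_num

lemma abs_lowerIndicator_le_one (t : ℝ) (y : X) : |lowerIndicator X t y| ≤ 1 := by
  rw [abs_of_nonneg (lowerIndicator_nonneg t y)]
  exact lowerIndicator_le_one t y

lemma lowerIndicator_mono {s t : ℝ} (h : s ≤ t) (y : X) :
    lowerIndicator X s y ≤ lowerIndicator X t y := by
  unfold lowerIndicator
  split_ifs with h1 h2 <;> first | exact absurd (h1.trans h) h2 | norm_num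

lemma measurable_lowerIndicator (t : ℝ) : Measurable (lowerIndicator X t) :=
  Measurable.ite (measurableSet_le measurable_subtype_coe measurable_const) measurable_const
    measurable_const

lemma isBounded_range_lowerIndicator (t : ℝ) :
    Bornology.IsBounded (range (lowerIndicator X t)) :=
  isBounded_iff_forall_norm_le.2 ⟨1, by rintro _ ⟨y, rfl⟩; exact abs_lowerIndicator_le_one t y⟩

lemma birkhoffAverage_lowerIndicator_mono (f : X → X) {s t : ℝ} (h : s ≤ t) (n : ℕ) (x : X) :
    birkhoffAverage ℝ f (lowerIndicator X s) n x ≤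
      birkhoffAverage ℝ f (lowerIndicator X t) n x := by
  simp only [birkhoffAverage, birkhoffSum, smul_eq_mul]
  gcongr
  exact lowerIndicator_mono h _

lemma birkhoffAverage_lowerIndicator_nonneg (f : X → X) (t : ℝ) (n : ℕ) (x : X) :
    0 ≤ birkhoffAverage ℝ f (lowerIndicator X t) n x :=
  mul_nonneg (by positivity) (Finset.sum_nonneg fun _ _ => lowerIndicator_nonneg _ _)

lemma birkhoffAverage_lowerIndicator_le_one (f : X → X) (t : ℝ) (n : ℕ) (x : X) :
    birkhoffAverage ℝ f (lowerIndicator X t) n x ≤ 1 := by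
  have h : birkhoffSum f (lowerIndicator X t) n x ≤ n := by
    simpa [birkhoffSum] using Finset.sum_le_sum fun k (_ : k ∈ Finset.range n) =>
      lowerIndicator_le_one t (f^[k] x)
  rw [birkhoffAverage, smul_eq_mul, inv_mul_eq_div]
  exact div_le_one_of_le₀ h n.cast_nonneg

/-- If the orbit of `x` has asymptotic frequencies `F q` in the half-lines `(-∞, q]` for all
rational `q`, and `x` returns infinitely often to each jump set of `F` containing it, then the
orbit of `x` has an asymptotic frequency in `(-∞, x]`. -/
lemma exists_tendsto_birkhoffAverage_self {f : X → X} {x : X} {F : ℚ → ℝ}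
    (hF : ∀ q : ℚ, Tendsto (birkhoffAverage ℝ f (lowerIndicator X q) · x) atTop (𝓝 (F q)))
    (hrec : ∀ k : ℕ, (x : ℝ) ∈ jumpSet F (1 / (k + 1)) →
      ∃ᶠ n in atTop, (f^[n] x : ℝ) ∈ jumpSet F (1 / (k + 1))) :
    ∃ a, Tendsto (birkhoffAverage ℝ f (lowerIndicator X x) · x) atTop (𝓝 a) := by
  have hmono : Monotone F := fun p q hpq => le_of_tendsto_of_tendsto' (hF p) (hF q) fun n =>
    birkhoffAverage_lowerIndicator_mono f (by exact_mod_cast hpq) n x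
  have h0 : ∀ q, 0 ≤ F q := fun q =>
    ge_of_tendsto' (hF q) fun n => birkhoffAverage_lowerIndicator_nonneg f q n x
  have h1 : ∀ q, F q ≤ 1 := fun q =>
    le_of_tendsto' (hF q) fun n => birkhoffAverage_lowerIndicator_le_one f q n x
  by_cases hx : ∃ k : ℕ, (x : ℝ) ∈ jumpSet F (1 / (k + 1))
  · obtain ⟨k, hk⟩ := hx
    have hfin : (jumpSet F (1 / (k + 1))).Finite := finite_jumpSet hmono h0 h1 (by positivity)
    have hinf : {n | (f^[n] x : ℝ) ∈ jumpSet F (1 / (k + 1))}.Infinite :=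
      Nat.frequently_atTop_iff_infinite.1 (hrec k hk)
    obtain ⟨m, -, n, -, hmn, heq⟩ := hinf.exists_lt_map_eq_of_mapsTo
      (f := fun n => (f^[n] x : ℝ)) (fun n hn => hn) hfin
    exact exists_tendsto_birkhoffAverage_of_iterate_eq (isBounded_range_lowerIndicator _) hmn
      (Subtype.ext heq)
  · refine tendsto_of_no_upcrossings dense_univ ?_
      (isBoundedUnder_of ⟨1, fun n => birkhoffAverage_lowerIndicator_le_one f x n x⟩)
      (isBoundedUnder_of ⟨0, fun n => birkhoffAverage_lowerIndicator_nonneg f x n x⟩)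
    rintro a - b - hab ⟨ha, hb⟩
    obtain ⟨k, hk⟩ := exists_nat_one_div_lt (sub_pos.2 hab)
    refine hx ⟨k, fun q q' hq hq' => ?_⟩
    have hqa : F q ≤ a := le_of_tendsto_of_frequently (hF q) (ha.mono fun n hn =>
      (birkhoffAverage_lowerIndicator_mono f hq.le n x).trans hn.le)
    have hbq : b ≤ F q' := ge_of_tendsto_of_frequently (hF q') (hb.mono fun n hn =>
      hn.le.trans (birkhoffAverage_lowerIndicator_mono f hq'.le n x))
    linarith

lemma ae_exists_tendsto_birkhoffAverage_self {f : X → X} {μ : Measure X} [IsFiniteMeasure μ]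
    (hf : MeasurePreserving f μ μ) :
    ∀ᵐ x : X ∂μ, ∃ a, Tendsto (birkhoffAverage ℝ f (lowerIndicator X x) · x) atTop (𝓝 a) := by
  have hlim : ∀ q : ℚ, ∃ L : X → ℝ, Measurable L ∧
      ∀ᵐ x ∂μ, Tendsto (birkhoffAverage ℝ f (lowerIndicator X q) · x) atTop (𝓝 (L x)) :=
    fun q => measurable_limit_of_tendsto_metrizable_ae
      (fun n => (measurable_birkhoffAverage hf.measurable
        (measurable_lowerIndicator _) n).aemeasurable)
      (ae_exists_tendsto_birkhoffAverage hf (measurable_lowerIndicator _)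
        (abs_lowerIndicator_le_one _))
  choose L hLm hL using hlim
  have hmeas : ∀ δ : ℝ, MeasurableSet {x : X | (x : ℝ) ∈ jumpSet (fun q => L q x) δ} := by
    intro δ
    have : {x : X | (x : ℝ) ∈ jumpSet (fun q => L q x) δ} = ⋂ (q : ℚ) (q' : ℚ),
        ({x : X | (q : ℝ) < x}ᶜ ∪ ({x : X | (x : ℝ) < q'}ᶜ ∪ {x | δ ≤ L q' x - L q x})) := by
      ext x
      simp [jumpSet, imp_iff_not_or]
    rw [this]
    refine .iInter fun q => .iInter fun q' => .union (.compl ?_) (.union (.compl ?_) ?_)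
    · exact measurableSet_lt measurable_const measurable_subtype_coe
    · exact measurableSet_lt measurable_subtype_coe measurable_const
    · exact measurableSet_le measurable_const ((hLm q').sub (hLm q))
  have hrec : ∀ᵐ x ∂μ, ∀ k : ℕ, (x : ℝ) ∈ jumpSet (fun q => L q x) (1 / (k + 1)) →
      ∃ᶠ n in atTop, (f^[n] x : ℝ) ∈ jumpSet (fun q => L q (f^[n] x)) (1 / (k + 1)) :=
    ae_all_iff.2 fun k =>
      hf.conservative.ae_mem_imp_frequently_image_mem (hmeas _).nullMeasurableSet
  have horbit : ∀ᵐ x ∂μ, ∀ (n : ℕ) (q : ℚ),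
      Tendsto (birkhoffAverage ℝ f (lowerIndicator X q) · (f^[n] x)) atTop (𝓝 (L q (f^[n] x))) :=
    ae_all_iff.2 fun n => (hf.iterate n).quasiMeasurePreserving.ae (ae_all_iff.2 hL)
  filter_upwards [hrec, horbit] with x hx hxo
  refine exists_tendsto_birkhoffAverage_self (F := fun q => L q x) (hxo 0) fun k hk => ?_
  refine (hx k hk).mono fun n hn => ?_
  have hinv : ∀ q, L q (f^[n] x) = L q x := fun q => tendsto_nhds_unique (hxo n q)
    ((tendsto_birkhoffAverage_iterate_iff (isBounded_range_lowerIndicator _) n).2 (hxo 0 q))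
  simpa only [hinv] using hn

lemma ordIdx_self_eq_birkhoffSum (f : X → X) (d : ℕ) (x : X) :
    (ordIdx f d d x : ℝ) = birkhoffSum f (lowerIndicator X x) d (f x) := by
  rw [ordIdx, Finset.natCast_card_filter, birkhoffSum, ← Finset.sum_range_reflect]
  refine Finset.sum_congr rfl fun r hr => ?_
  have hr := Finset.mem_range.1 hr
  rw [← iterate_succ_apply, show d - (d - 1 - r) = r.succ by omega]
  simp [lowerIndicator]

end lowerIndicator

/-- There exists a Borel set `X̃ ⊆ X` of full measure with `f(X̃) ⊆ X̃` on which
`α(x) = lim_{d→∞} i_{d,d}(x)/d` exists. -/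
theorem exists_forward_invariant_full_measure_limit
    {X : Set ℝ} (f : X → X) (μ : Measure X) [IsProbabilityMeasure μ]
    (hf : MeasurePreserving f μ μ) :
    ∃ Xt : Set X, MeasurableSet Xt ∧ μ Xt = 1 ∧ Set.MapsTo f Xt Xt ∧
      ∀ x ∈ Xt, ∃ a : ℝ,
        Tendsto (fun d : ℕ => (ordIdx f d d x : ℝ) / d) atTop (nhds a) := by
  set N := toMeasurable μ {x : X | ¬ ∃ a,
    Tendsto (birkhoffAverage ℝ f (lowerIndicator X x) · x) atTop (𝓝 a)}
  have hN : MeasurableSet N := measurableSet_toMeasurable _ _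
  have hN0 : μ N = 0 := (measure_toMeasurable _).trans (ae_exists_tendsto_birkhoffAverage_self hf)
  refine ⟨⋂ n, f^[n] ⁻¹' Nᶜ, .iInter fun n => hf.measurable.iterate n hN.compl, ?_, ?_, ?_⟩
  · rw [← prob_compl_eq_zero_iff (.iInter fun n => hf.measurable.iterate n hN.compl),
      compl_iInter, measure_iUnion_null_iff]
    intro n
    rw [← preimage_compl, compl_compl, (hf.iterate n).measure_preimage hN.nullMeasurableSet, hN0]
  · intro x hx
    simp only [mem_iInter, mem_preimage] at hx ⊢
    exact fun n => by simpa only [iterate_succ_apply] using hx (n + 1)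
  · intro x hx
    obtain ⟨a, ha⟩ : ∃ a, Tendsto (birkhoffAverage ℝ f (lowerIndicator X x) · x) atTop (𝓝 a) := by
      by_contra h
      exact mem_iInter.1 hx 0 (subset_toMeasurable μ _ h)
    refine ⟨a, ((tendsto_birkhoffAverage_apply_iff (isBounded_range_lowerIndicator _)).2
      ha).congr fun d => ?_⟩
    rw [ordIdx_self_eq_birkhoffSum, birkhoffAverage, smul_eq_mul, inv_mul_eq_div]
end
end

section
/- Let X ⊆ ℝ, let f : X → X be Borel measurable, and let μ be an f-invariant ergodic Borel probability measure on X. Then there exists a set X̃ ⊆ X with μ(X̃) = 1 and f(X̃) ⊆ X̃ such that any two different points of X̃ realize different ordinal patterns of some order d; that is, for all x, y ∈ X̃ with x ≠ y there is d ∈ ℕ with i_d(x) ≠ i_d(y). -/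
open MeasureTheory Filter Set Function
open scoped Classical ENNReal Topology

noncomputable section

/-- **Mean ergodic theorem, in measure**: for an ergodic map, the visiting frequencies of a
measurable set converge in measure to its measure. -/
theorem Ergodic.tendstoInMeasure_birkhoffAverage_indicator {α : Type*} [MeasurableSpace α]
    {μ : Measure α} [IsProbabilityMeasure μ] {f : α → α} (hf : Ergodic f μ) {A : Set α}
    (hA : MeasurableSet A) :
    TendstoInMeasure μ (birkhoffAverage ℝ f (A.indicator fun _ ↦ (1 : ℝ))) atTop
      fun _ ↦ μ.real A := by
  have hmp := hf.toMeasurePreserving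
  let T : Lp ℝ 2 μ →L[ℝ] Lp ℝ 2 μ := (Lp.compMeasurePreservingₗᵢ ℝ f hmp).toContinuousLinearMap
  have hT : ⇑T = Lp.compMeasurePreserving f hmp := rfl
  let g : Lp ℝ 2 μ := indicatorConstLp 2 hA (measure_ne_top μ A) (1 : ℝ)
  let e : Lp ℝ 2 μ := indicatorConstLp 2 MeasurableSet.univ (measure_ne_top μ univ) (1 : ℝ)
  let P := (T.eqLocus (1 : Lp ℝ 2 μ →L[ℝ] Lp ℝ 2 μ)).orthogonalProjectionOnto g
  have hlim : Tendsto (birkhoffAverage ℝ T _root_.id · g) atTop (𝓝 (P : Lp ℝ 2 μ)) :=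
    T.tendsto_birkhoffAverage_orthogonalProjection
      (LinearIsometry.norm_toContinuousLinearMap_le _) g
  have hPfix : T P = P := P.2
  obtain ⟨c, hc⟩ : ∃ c, (P : Lp ℝ 2 μ) =ᵐ[μ] const α c := by
    refine hf.ae_eq_const_of_ae_eq_comp_ae (Lp.aestronglyMeasurable _) ?_
    have := Lp.coeFn_compMeasurePreserving (P : Lp ℝ 2 μ) hmp
    rw [← hT, hPfix] at this
    exact this.symm
  have hcA : c = μ.real A := by
    have he : e ∈ T.eqLocus (1 : Lp ℝ 2 μ →L[ℝ] Lp ℝ 2 μ) := by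
      change T e = e
      rw [hT]
      exact Lp.indicatorConstLp_compMeasurePreserving MeasurableSet.univ _ 1 hmp
    have h1 : inner ℝ e (g - P) = (0 : ℝ) :=
      Submodule.inner_right_of_mem_orthogonal he
        (Submodule.sub_starProjection_mem_orthogonal g)
    rw [inner_sub_right, sub_eq_zero] at h1
    have h2 : inner ℝ e (P : Lp ℝ 2 μ) = c := by
      rw [L2.inner_indicatorConstLp_one, setIntegral_univ, integral_congr_ae hc]
      simp
    have h3 : inner ℝ e g = μ.real A := by
      rw [L2.real_inner_indicatorConstLp_one_indicatorConstLp_one, univ_inter]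
    rw [← h2, ← h1, h3]
  refine (tendstoInMeasure_of_tendsto_Lp hlim).congr (fun n ↦ ?_) (hcA ▸ hc)
  have hk : ∀ k : ℕ, (T^[k] g : Lp ℝ 2 μ) =ᵐ[μ]
      fun x ↦ A.indicator (fun _ ↦ (1 : ℝ)) (f^[k] x) := by
    intro k
    rw [hT, Lp.compMeasurePreserving_iterate]
    refine (Lp.coeFn_compMeasurePreserving g (hmp.iterate k)).trans ?_
    exact (hmp.iterate k).quasiMeasurePreserving.ae_eq_comp indicatorConstLp_coeFn
  have hsum : (birkhoffSum T _root_.id n g : Lp ℝ 2 μ) =ᵐ[μ]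
      birkhoffSum f (A.indicator fun _ ↦ (1 : ℝ)) n := by
    induction n with
    | zero => simpa using Lp.coeFn_zero ℝ 2 μ
    | succ n ih =>
      rw [birkhoffSum_succ]
      filter_upwards [Lp.coeFn_add (birkhoffSum T _root_.id n g) (T^[n] g), ih, hk n]
        with x h1 h2 h3
      rw [birkhoffSum_succ, ← h2, ← h3]
      exact h1
  filter_upwards [Lp.coeFn_smul (n : ℝ)⁻¹ (birkhoffSum T _root_.id n g), hsum] with x h1 h2
  rw [birkhoffAverage, birkhoffAverage, ← h2]
  exact h1

/-- For any two measurable sets, almost every point visits both with the right frequency along a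
common subsequence of times. -/
theorem Ergodic.exists_seq_tendsto_birkhoffAverage_indicator {α : Type*} [MeasurableSpace α]
    {μ : Measure α} [IsProbabilityMeasure μ] {f : α → α} (hf : Ergodic f μ) {A B : Set α}
    (hA : MeasurableSet A) (hB : MeasurableSet B) :
    ∃ ns : ℕ → ℕ, ∀ᵐ x ∂μ,
      Tendsto (fun i ↦ birkhoffAverage ℝ f (A.indicator fun _ ↦ (1 : ℝ)) (ns i) x) atTop
        (𝓝 (μ.real A)) ∧
      Tendsto (fun i ↦ birkhoffAverage ℝ f (B.indicator fun _ ↦ (1 : ℝ)) (ns i) x) atTop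
        (𝓝 (μ.real B)) := by
  obtain ⟨ns, hns, h1⟩ :=
    (hf.tendstoInMeasure_birkhoffAverage_indicator hA).exists_seq_tendsto_ae
  obtain ⟨ms, hms, h2⟩ :=
    ((hf.tendstoInMeasure_birkhoffAverage_indicator hB).comp
      hns.tendsto_atTop).exists_seq_tendsto_ae
  refine ⟨ns ∘ ms, ?_⟩
  filter_upwards [h1, h2] with x hx1 hx2
  exact ⟨hx1.comp hms.tendsto_atTop, hx2⟩

/-- Almost no point `y > p` is joined to `p` by a null interval. -/
theorem measure_setOf_measure_Ioc_eq_zero (ν : Measure ℝ) (p : ℝ) :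
    ν {y | p < y ∧ ν (Ioc p y) = 0} = 0 := by
  set N := {y | p < y ∧ ν (Ioc p y) = 0}
  refine measure_null_of_locally_null N fun y hy ↦ ?_
  by_cases h : ∃ z ∈ N, y < z
  · obtain ⟨z, hz, hyz⟩ := h
    refine ⟨N ∩ Iio z, inter_mem_nhdsWithin _ (Iio_mem_nhds hyz), measure_mono_null ?_ hz.2⟩
    exact fun w hw ↦ ⟨hw.1.1, le_of_lt hw.2⟩
  · push Not at h
    exact ⟨N, self_mem_nhdsWithin, measure_mono_null (t := Ioc p y) (fun w hw ↦ ⟨hw.1, h w hw⟩) hy.2⟩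

/-- For a finite measure on `ℝ` there are countably many thresholds which, for almost every `y`,
witness that the distribution function is strictly smaller to the left of `y`. -/
theorem exists_countable_measure_Ioc_pos (ν : Measure ℝ) [IsFiniteMeasure ν] :
    ∃ D : Set ℝ, D.Countable ∧ ∀ᵐ y ∂ν, ∀ x < y, ∃ p ∈ D, ∃ q ∈ D,
      x ≤ p ∧ p < q ∧ q ≤ y ∧ 0 < ν (Ioc p q) := by
  refine ⟨range ((↑) : ℚ → ℝ) ∪ {a | 0 < ν {a}}, (countable_range _).union ?_, ?_⟩
  · exact Measure.countable_meas_pos_of_disjoint_iUnion (μ := ν) (As := fun a : ℝ ↦ {a})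
      (fun a ↦ measurableSet_singleton a) fun a b hab ↦ disjoint_singleton.2 hab
  have hN : ∀ᵐ y ∂ν, ∀ p : ℚ, ¬ ((p : ℝ) < y ∧ ν (Ioc (p : ℝ) y) = 0) :=
    ae_all_iff.2 fun p ↦ by
      simpa [ae_iff] using measure_setOf_measure_Ioc_eq_zero ν p
  filter_upwards [hN] with y hy x hxy
  obtain ⟨p, hxp, hpy⟩ := exists_rat_btwn hxy
  have hpos : 0 < ν (Ioc (p : ℝ) y) := pos_iff_ne_zero.2 fun h ↦ hy p ⟨hpy, h⟩
  by_cases hat : 0 < ν {y}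
  · exact ⟨p, .inl ⟨p, rfl⟩, y, .inr hat, hxp.le, hpy, le_rfl, hpos⟩
  by_contra! hcon
  refine hpos.ne' (measure_mono_null (t := {y} ∪ ⋃ q : {q : ℚ // p < q ∧ (q : ℝ) < y},
    Ioc (p : ℝ) (q : ℚ)) ?_ ?_)
  · rintro z ⟨hpz, hzy⟩
    rcases hzy.eq_or_lt with rfl | hzy
    · exact .inl rfl
    · obtain ⟨q, hzq, hqy⟩ := exists_rat_btwn hzy
      exact .inr (mem_iUnion.2 ⟨⟨q, by exact_mod_cast hpz.trans hzq, hqy⟩, hpz, hzq.le⟩)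
  · refine measure_union_null (nonpos_iff_eq_zero.1 (not_lt.1 hat)) (measure_iUnion_null ?_)
    rintro ⟨q, hpq, hqy⟩
    exact nonpos_iff_eq_zero.1 (hcon p (.inl ⟨p, rfl⟩) q (.inl ⟨q, rfl⟩) hxp.le
      (by exact_mod_cast hpq) hqy.le)

/-- An almost sure property holds on a forward invariant measurable set of
full measure. -/
theorem MeasureTheory.MeasurePreserving.exists_mapsTo_of_ae {α : Type*} [MeasurableSpace α]
    {μ : Measure α} [IsProbabilityMeasure μ] {f : α → α} (hf : MeasurePreserving f μ μ)
    {p : α → Prop} (hp : ∀ᵐ x ∂μ, p x) :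
    ∃ s : Set α, MeasurableSet s ∧ μ s = 1 ∧ MapsTo f s s ∧ ∀ x ∈ s, p x := by
  obtain ⟨t, htp, ht, htμ⟩ := exists_measurable_superset_of_null (ae_iff.1 hp)
  have hs : MeasurableSet (⋂ n : ℕ, f^[n] ⁻¹' tᶜ) :=
    .iInter fun n ↦ (hf.iterate n).measurable ht.compl
  refine ⟨⋂ n : ℕ, f^[n] ⁻¹' tᶜ, hs, ?_, ?_, ?_⟩
  · rw [← prob_compl_eq_zero_iff hs]
    simp only [compl_iInter, ← preimage_compl, compl_compl]
    exact measure_iUnion_null fun n ↦ by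
      rw [(hf.iterate n).measure_preimage ht.nullMeasurableSet, htμ]
  · intro x hx
    rw [mem_iInter] at hx ⊢
    exact fun n ↦ hx (n + 1)
  · intro x hx
    by_contra h
    exact mem_iInter.1 hx 0 (htp h)

theorem ordIdx_succ_self {X : Set ℝ} (f : X → X) (d : ℕ) (x : X) :
    ordIdx f (d + 1) (d + 1) x = ordIdx f d d x + if f^[d + 1] x ≤ x then 1 else 0 := by
  simp only [ordIdx, Finset.card_filter, Finset.sum_range_succ', Nat.sub_self, Nat.sub_zero,
    Nat.add_sub_add_right, iterate_zero, _root_.id]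

/-- Points with the same ordinal patterns have the same return times to the half-line below. -/
theorem iterate_le_iff_of_ordIdx_eq {X : Set ℝ} {f : X → X} {x y : X}
    (h : ∀ d l : ℕ, 1 ≤ l → l ≤ d → ordIdx f d l x = ordIdx f d l y) (k : ℕ) :
    f^[k] x ≤ x ↔ f^[k] y ≤ y := by
  have h' : ∀ d, ordIdx f d d x = ordIdx f d d y := by
    rintro (_ | d)
    · simp [ordIdx]
    · exact h _ _ (by omega) le_rfl
  cases k with
  | zero => simp
  | succ k =>
    have := h' (k + 1)
    rw [ordIdx_succ_self, ordIdx_succ_self, h' k] at this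
    replace this := Nat.add_left_cancel this
    split_ifs at this with hx hy hy
    · exact iff_of_true hx hy
    · exact iff_of_false hx hy

/-- In the ergodic case, ordinal patterns separate points: there is a set `X̃ ⊆ X`
of full measure with `f(X̃) ⊆ X̃` such that any two different points of `X̃` realize
different ordinal patterns of some order `d`. -/
theorem ordinal_patterns_separate_points
    {X : Set ℝ} (f : X → X) (μ : Measure X) [IsProbabilityMeasure μ]
    (hf : Ergodic f μ) :
    ∃ Xt : Set X, MeasurableSet Xt ∧ μ Xt = 1 ∧ Set.MapsTo f Xt Xt ∧
      ∀ x ∈ Xt, ∀ y ∈ Xt, x ≠ y →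
        ∃ d : ℕ, 1 ≤ d ∧ ∃ l : ℕ, 1 ≤ l ∧ l ≤ d ∧ ordIdx f d l x ≠ ordIdx f d l y := by
  obtain ⟨D, hD, hsep⟩ := exists_countable_measure_Ioc_pos (μ.map ((↑) : X → ℝ))
  let A : ℝ → Set X := fun a ↦ {z | (z : ℝ) ≤ a}
  have hA : ∀ a, MeasurableSet (A a) := fun a ↦ measurable_subtype_coe measurableSet_Iic
  choose ns hns using fun p q : ℝ ↦
    hf.exists_seq_tendsto_birkhoffAverage_indicator (hA p) (hA q)
  have hfreq := (ae_ball_iff hD).2 fun p _ ↦ (ae_ball_iff hD).2 fun q _ ↦ hns p q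
  obtain ⟨s, hs, hμs, hmaps, hgood⟩ := hf.toMeasurePreserving.exists_mapsTo_of_ae
    (hfreq.and (ae_of_ae_map measurable_subtype_coe.aemeasurable hsep))
  refine ⟨s, hs, hμs, hmaps, fun x hx y hy hne ↦ ?_⟩
  by_contra! hpat
  wlog hxy : x < y generalizing x y
  · exact this y hy x hx hne.symm
      (fun d hd l hl hld ↦ (hpat d hd l hl hld).symm) (hne.lt_or_gt.resolve_left hxy)
  have hret := iterate_le_iff_of_ordIdx_eq
    fun d l hl hld ↦ hpat d (hl.trans hld) l hl hld
  obtain ⟨p, hp, q, hq, hxp, hpq, hqy, hpos⟩ := (hgood y hy).2 x hxy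
  have hle : μ.real (A q) ≤ μ.real (A p) := by
    refine le_of_tendsto_of_tendsto' ((hgood y hy).1 p hp q hq).2
      ((hgood x hx).1 p hp q hq).1 fun i ↦ ?_
    refine smul_le_smul_of_nonneg_left (Finset.sum_le_sum fun k _ ↦ ?_) (by positivity)
    by_cases hk : f^[k] y ∈ A q
    · have hky : f^[k] y ≤ y := (show (f^[k] y : ℝ) ≤ q from hk).trans hqy
      have hkx : f^[k] x ∈ A p := (show (f^[k] x : ℝ) ≤ x from (hret k).2 hky).trans hxp
      rw [indicator_of_mem hk, indicator_of_mem hkx]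
    · rw [indicator_of_notMem hk]
      exact indicator_nonneg (fun _ _ ↦ zero_le_one) _
  have hsub : A p ⊆ A q := fun z hz ↦ le_trans hz hpq.le
  have hdiff : ((↑) : X → ℝ) ⁻¹' Ioc p q = A q \ A p := by
    ext z
    simp [A, and_comm]
  rw [Measure.map_apply measurable_subtype_coe measurableSet_Ioc, hdiff] at hpos
  have hlt := ENNReal.toReal_pos hpos.ne' (measure_ne_top μ _)
  rw [← measureReal_def, measureReal_sdiff hsub (hA p)] at hlt
  linarith
end
end
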